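/- Let A ⊆ ℝⁿ be a bounded closed set with 0 ∈ A ⊆ B₁ and Ω := ℝⁿ \ A. Let u be continuous on the closure of Ω and infinity harmonic in Ω with S⁻_∞ = S⁺_∞ = 1. Then there exists a function W : ℝⁿ → ℝ that is infinity harmonic in all of ℝⁿ with Lip(W, ℝⁿ) ≤ 1, such that either W ≤ u throughout Ω or W ≥ u throughout Ω. -/

import Mathlib

open Metric Set Filter Bornology Topology
open scoped RealInnerProductSpace

noncomputable section

/-- Euclidean space ℝⁿ. -/
abbrev Euc (n : ℕ) := EuclideanSpace ℝ (Fin n)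

/-- Comparison with cones from above (infinity subharmonic). -/
def CmpAbove {n : ℕ} (Ω : Set (Euc n)) (u : Euc n → ℝ) : Prop :=
  ∀ V : Set (Euc n), IsOpen V → IsBounded V → closure V ⊆ Ω →
    ∀ (x₀ : Euc n) (a b : ℝ),
      (∀ x ∈ frontier (V \ {x₀}), u x ≤ a * ‖x - x₀‖ + b) →
      ∀ x ∈ V, u x ≤ a * ‖x - x₀‖ + b

/-- Comparison with cones from below (infinity superharmonic). -/
def CmpBelow {n : ℕ} (Ω : Set (Euc n)) (u : Euc n → ℝ) : Prop :=
  ∀ V : Set (Euc n), IsOpen V → IsBounded V → closure V ⊆ Ω →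
    ∀ (x₀ : Euc n) (a b : ℝ),
      (∀ x ∈ frontier (V \ {x₀}), a * ‖x - x₀‖ + b ≤ u x) →
      ∀ x ∈ V, a * ‖x - x₀‖ + b ≤ u x

/-- Infinity harmonic = comparison with cones from both sides. -/
def InfHarmonic {n : ℕ} (Ω : Set (Euc n)) (u : Euc n → ℝ) : Prop :=
  CmpAbove Ω u ∧ CmpBelow Ω u

/-- m⁺ = max of u on ∂Ω. -/
def mP {n : ℕ} (Ω : Set (Euc n)) (u : Euc n → ℝ) : ℝ := sSup (u '' frontier Ω)

/-- m⁻ = min of u on ∂Ω. -/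
def mM {n : ℕ} (Ω : Set (Euc n)) (u : Euc n → ℝ) : ℝ := sInf (u '' frontier Ω)

/-- S⁺_r := (max(max_{∂B_r} u, m⁺) − m⁺)/r. -/
def SP {n : ℕ} (Ω : Set (Euc n)) (u : Euc n → ℝ) (r : ℝ) : ℝ :=
  (max (sSup (u '' sphere (0 : Euc n) r)) (mP Ω u) - mP Ω u) / r

/-- S⁻_r := (m⁻ − min(min_{∂B_r} u, m⁻))/r. -/
def SM {n : ℕ} (Ω : Set (Euc n)) (u : Euc n → ℝ) (r : ℝ) : ℝ :=
  (mM Ω u - min (sInf (u '' sphere (0 : Euc n) r)) (mM Ω u)) / r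

/-- Lip(u, S) := sup_{x≠y ∈ S} |u(x) − u(y)|/|x − y|. -/
def lipOn {n : ℕ} (u : Euc n → ℝ) (S : Set (Euc n)) : ℝ :=
  sSup ((fun p : Euc n × Euc n => |u p.1 - u p.2| / ‖p.1 - p.2‖) ''
    {p : Euc n × Euc n | p.1 ∈ S ∧ p.2 ∈ S ∧ p.1 ≠ p.2})

/-- Comparison with cones from above on open sets that may touch the boundary of `Ω`. -/
def ConeAbove {n : ℕ} (Ω : Set (Euc n)) (u : Euc n → ℝ) : Prop :=
  ∀ U : Set (Euc n), IsOpen U → IsBounded U → U ⊆ Ω → ∀ x₀ ∉ U, ∀ a b : ℝ,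
    (∀ x ∈ frontier U, u x ≤ a * ‖x - x₀‖ + b) → ∀ x ∈ U, u x ≤ a * ‖x - x₀‖ + b

theorem CmpAbove.congr {n : ℕ} {Ω : Set (Euc n)} {u v : Euc n → ℝ}
    (h : CmpAbove Ω u) (huv : ∀ x ∈ Ω, u x = v x) : CmpAbove Ω v := by
  intro V hV hb hc x₀ a b hf x hx
  rw [← huv x (hc (subset_closure hx))]
  refine h V hV hb hc x₀ a b (fun y hy => ?_) x hx
  rw [huv y (hc (closure_mono sdiff_subset (frontier_subset_closure hy)))]
  exact hf y hy

theorem cmpBelow_iff_cmpAbove_neg {n : ℕ} {Ω : Set (Euc n)} {u : Euc n → ℝ} :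
    CmpBelow Ω u ↔ CmpAbove Ω (fun x => -u x) := by
  constructor
  · intro h V hV hb hc x₀ a b hf x hx
    have := h V hV hb hc x₀ (-a) (-b) (fun y hy => by linarith [hf y hy]) x hx
    linarith
  · intro h V hV hb hc x₀ a b hf x hx
    have := h V hV hb hc x₀ (-a) (-b) (fun y hy => by linarith [hf y hy]) x hx
    linarith

theorem CmpAbove.coneAbove {n : ℕ} {Ω : Set (Euc n)} {u : Euc n → ℝ}
    (h : CmpAbove Ω u) (hu : Continuous u) : ConeAbove Ω u := by
  intro U hU hb hUΩ x₀ hx₀ a b hf x hx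
  refine le_of_forall_pos_le_add fun δ hδ => ?_
  by_contra! hlt
  have hC : Continuous fun y : Euc n => a * ‖y - x₀‖ + b + δ := by fun_prop
  set V : Set (Euc n) := U ∩ {y | a * ‖y - x₀‖ + b + δ < u y} with hVdef
  have hVo : IsOpen V := hU.inter (isOpen_lt hC hu)
  have hcl : closure V ⊆ U := by
    intro y hy
    have h1 : y ∈ closure U := closure_mono inter_subset_left hy
    have h2 : a * ‖y - x₀‖ + b + δ ≤ u y :=
      closure_minimal (fun z hz => le_of_lt hz.2) (isClosed_le hC hu) hy
    by_contra hyU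
    have := hf y (by rw [hU.frontier_eq]; exact ⟨h1, hyU⟩)
    linarith
  have hx₀V : V \ {x₀} = V := sdiff_singleton_eq_self fun h => hx₀ h.1
  have hxV : x ∈ V := ⟨hx, hlt⟩
  have := h V hVo (hb.subset inter_subset_left) (hcl.trans hUΩ) x₀ a (b + δ) (by
    rw [hx₀V, hVo.frontier_eq]
    rintro y ⟨hy, hyV⟩
    by_contra! hlt'
    exact hyV ⟨hcl hy, by simp only [mem_ofPred_eq]; linarith⟩) x hxV
  linarith

theorem ConeAbove.cmpAbove {n : ℕ} [Nontrivial (Euc n)] {Ω : Set (Euc n)} {u : Euc n → ℝ}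
    (h : ConeAbove Ω u) : CmpAbove Ω u := by
  intro V hV hb hc x₀ a b hf x hx
  have hO : IsOpen (V \ {x₀}) := hV.sdiff isClosed_singleton
  by_cases hxx : x = x₀
  · subst hxx
    apply hf
    rw [hO.frontier_eq]
    refine ⟨?_, fun h => h.2 rfl⟩
    have : x ∈ closure (V ∩ {x}ᶜ) :=
      hV.inter_closure ⟨hx, by rw [(dense_compl_singleton x).closure_eq]; trivial⟩
    rwa [sdiff_eq]
  · exact h _ hO (hb.subset sdiff_subset) (sdiff_subset.trans (subset_closure.trans hc)) x₀
      (fun h => h.2 rfl) a b hf x ⟨hx, hxx⟩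

theorem exists_mem_segment_frontier {n : ℕ} {U : Set (Euc n)} {x y : Euc n}
    (hx : x ∈ U) (hy : y ∉ U) : ∃ p ∈ segment ℝ x y, p ∈ frontier U := by
  by_contra! h
  obtain ⟨p, -, hp⟩ := (convex_segment x y).isPreconnected (interior U) (closure U)ᶜ
    isOpen_interior isClosed_closure.isOpen_compl
    (fun p hp => by
      by_contra hc
      rw [mem_union, not_or, notMem_compl_iff] at hc
      exact h p hp ⟨hc.2, hc.1⟩)
    ⟨x, left_mem_segment ℝ x y, by
      by_contra hc
      exact h x (left_mem_segment ℝ x y) ⟨subset_closure hx, hc⟩⟩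
    ⟨y, right_mem_segment ℝ x y, fun hc =>
      h y (right_mem_segment ℝ x y) ⟨hc, fun hi => hy (interior_subset hi)⟩⟩
  exact hp.2 (subset_closure (interior_subset hp.1))

/-- An `L`-Lipschitz function enjoys comparison from above with cones of slope at least `L`. -/
theorem le_cone_of_lipschitz {n : ℕ} {U : Set (Euc n)} (hb : IsBounded U)
    {u : Euc n → ℝ} {L : ℝ} (hu : ∀ x y, u x - u y ≤ L * ‖x - y‖) {x₀ : Euc n} (hx₀ : x₀ ∉ U)
    {a b : ℝ} (ha : L ≤ |a|) (hf : ∀ x ∈ frontier U, u x ≤ a * ‖x - x₀‖ + b)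
    {x : Euc n} (hx : x ∈ U) : u x ≤ a * ‖x - x₀‖ + b := by
  rcases le_total 0 a with h0 | h0
  · rw [abs_of_nonneg h0] at ha
    obtain ⟨p, hp, hpU⟩ := exists_mem_segment_frontier hx hx₀
    have h1 := hf p hpU
    have h2 := hu x p
    have h3 : ‖x - p‖ + ‖p - x₀‖ = ‖x - x₀‖ := by
      simpa [dist_eq_norm] using dist_add_dist_of_mem_segment hp
    have h4 : L * ‖x - p‖ ≤ a * ‖x - p‖ := by gcongr
    rw [← h3]; linarith
  · rw [abs_of_nonpos h0] at ha
    have hne : 0 < ‖x - x₀‖ := norm_pos_iff.2 (sub_ne_zero.2 fun h => hx₀ (h ▸ hx))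
    obtain ⟨r, hr⟩ := hb.subset_closedBall x₀
    have hy : x₀ + (1 + (|r| / ‖x - x₀‖)) • (x - x₀) ∉ U := by
      intro h
      have := hr h
      rw [mem_closedBall, dist_eq_norm, add_sub_cancel_left, norm_smul, Real.norm_eq_abs,
        abs_of_nonneg (by positivity), add_mul, div_mul_cancel₀ _ hne.ne'] at this
      linarith [le_abs_self r]
    obtain ⟨p, hp, hpU⟩ := exists_mem_segment_frontier hx hy
    have h1 := hf p hpU
    have h2 := hu x p
    have h3 : ‖x₀ - x‖ + ‖x - p‖ = ‖x₀ - p‖ := by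
      obtain ⟨t, ht, rfl⟩ := (segment_eq_image' ℝ _ _).subset hp
      have e1 : x₀ + (1 + (|r| / ‖x - x₀‖)) • (x - x₀) - x = (|r| / ‖x - x₀‖) • (x - x₀) := by
        module
      have e2 : x - (x + t • (|r| / ‖x - x₀‖) • (x - x₀)) = -((t * (|r| / ‖x - x₀‖)) • (x - x₀)) := by
        module
      have e3 : x₀ - (x + t • (|r| / ‖x - x₀‖) • (x - x₀))
          = -((1 + t * (|r| / ‖x - x₀‖)) • (x - x₀)) := by
        module
      have ht0 : 0 ≤ t := ht.1
      simp only [e1]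
      rw [e2, e3, norm_neg, norm_neg, norm_smul, norm_smul, norm_sub_rev x₀ x,
        Real.norm_of_nonneg (by positivity), Real.norm_of_nonneg (by positivity)]
      ring
    have h4 : L * ‖x - p‖ ≤ -a * ‖x - p‖ := by gcongr
    rw [norm_sub_rev p x₀, ← h3, norm_sub_rev x₀ x] at h1
    linarith

theorem cone_sub_le {n : ℕ} (a b : ℝ) (x₀ x y : Euc n) :
    (a * ‖x - x₀‖ + b) - (a * ‖y - x₀‖ + b) ≤ |a| * ‖x - y‖ := by
  calc (a * ‖x - x₀‖ + b) - (a * ‖y - x₀‖ + b) = a * (‖x - x₀‖ - ‖y - x₀‖) := by ring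
    _ ≤ |a * (‖x - x₀‖ - ‖y - x₀‖)| := le_abs_self _
    _ = |a| * |‖x - x₀‖ - ‖y - x₀‖| := abs_mul _ _
    _ ≤ |a| * ‖x - y‖ := by
      gcongr
      simpa using abs_norm_sub_norm_le (x - x₀) (y - x₀)

/-- Cones enjoy comparison with cones on sets that avoid both vertices. -/
theorem cone_le_cone {n : ℕ} {U : Set (Euc n)} (hb : IsBounded U) {z x₀ : Euc n}
    (hz : z ∉ U) (hx₀ : x₀ ∉ U) {α β a b : ℝ}
    (hf : ∀ x ∈ frontier U, α * ‖x - z‖ + β ≤ a * ‖x - x₀‖ + b)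
    {x : Euc n} (hx : x ∈ U) : α * ‖x - z‖ + β ≤ a * ‖x - x₀‖ + b := by
  rcases le_total |α| |a| with h | h
  · exact le_cone_of_lipschitz hb (u := fun x => α * ‖x - z‖ + β) (L := |α|)
      (fun x y => cone_sub_le _ _ _ _ _) hx₀ h hf hx
  · have := le_cone_of_lipschitz hb (u := fun x => (-a) * ‖x - x₀‖ + (-b)) (L := |a|)
      (a := -α) (b := -β)
      (fun x y => by simpa using cone_sub_le (-a) (-b) x₀ x y) hz (by simpa using h)
      (fun x hx => by linarith [hf x hx]) hx
    linarith

theorem coneAbove_iSup {n : ℕ} {ι : Sort*} [Nonempty ι] {D : Set (Euc n)} {w : ι → Euc n → ℝ}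
    (hb : ∀ x, BddAbove (range fun i => w i x)) (h : ∀ i, ConeAbove D (w i)) :
    ConeAbove D (fun x => ⨆ i, w i x) := by
  intro U hU hUb hUD x₀ hx₀ a b hf x hx
  exact ciSup_le fun i => h i U hU hUb hUD x₀ hx₀ a b
    (fun y hy => (le_ciSup (hb y) i).trans (hf y hy)) x hx

theorem iSup_sub_le {n : ℕ} {ι : Sort*} [Nonempty ι] {L : ℝ} {w : ι → Euc n → ℝ}
    (hb : ∀ x, BddAbove (range fun i => w i x)) (h : ∀ i x y, w i x - w i y ≤ L * ‖x - y‖)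
    (x y : Euc n) : (⨆ i, w i x) - (⨆ i, w i y) ≤ L * ‖x - y‖ := by
  rw [sub_le_iff_le_add]
  exact ciSup_le fun i => by linarith [h i x y, le_ciSup (hb y) i]

/-- Gluing a cone of slope at most `L` above an `L`-Lipschitz function. -/
theorem coneAbove_glue {n : ℕ} {D U : Set (Euc n)} {W : Euc n → ℝ} (hW : ConeAbove D W)
    (hU : IsOpen U) {x₀ : Euc n} (hx₀ : x₀ ∉ U) {a b : ℝ}
    (hf : ∀ x ∈ frontier U, a * ‖x - x₀‖ + b ≤ W x) [DecidablePred (· ∈ U)] :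
    ConeAbove D (fun x => if x ∈ U then max (W x) (a * ‖x - x₀‖ + b) else W x) := by
  intro O hO hOb hOD z hz α β hle x hx
  have hge : ∀ y, W y ≤ (if y ∈ U then max (W y) (a * ‖y - x₀‖ + b) else W y) := by
    intro y; split_ifs <;> simp
  have hWO := hW O hO hOb hOD z hz α β fun y hy => (hge y).trans (hle y hy)
  beta_reduce at hle ⊢
  split_ifs with hxU
  · refine max_le (hWO x hx) ?_
    refine cone_le_cone (U := O ∩ U) (hOb.subset inter_subset_left) (fun h => hx₀ h.2)
      (fun h => hz h.1) ?_ ⟨hx, hxU⟩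
    intro p hp
    rw [(hO.inter hU).frontier_eq] at hp
    have hpO : p ∈ closure O := closure_mono inter_subset_left hp.1
    have hpU : p ∈ closure U := closure_mono inter_subset_right hp.1
    have hfr : p ∉ O → p ∈ frontier O := fun h => by rw [hO.frontier_eq]; exact ⟨hpO, h⟩
    by_cases h1 : p ∈ U
    · have := hle p (hfr fun h => hp.2 ⟨h, h1⟩)
      rw [if_pos h1] at this
      exact (le_max_right _ _).trans this
    · refine (hf p (by rw [hU.frontier_eq]; exact ⟨hpU, h1⟩)).trans ?_
      by_cases h2 : p ∈ O
      · exact hWO p h2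
      · exact (hge p).trans (hle p (hfr h2))
  · exact hWO x hx

theorem glue_sub_le {n : ℕ} {U : Set (Euc n)} {W : Euc n → ℝ} {L : ℝ}
    (hW : ∀ x y, W x - W y ≤ L * ‖x - y‖) {x₀ : Euc n} {a b : ℝ} (ha : |a| ≤ L)
    (hf : ∀ x ∈ frontier U, a * ‖x - x₀‖ + b ≤ W x) [DecidablePred (· ∈ U)] (x y : Euc n) :
    (if x ∈ U then max (W x) (a * ‖x - x₀‖ + b) else W x) -
      (if y ∈ U then max (W y) (a * ‖y - x₀‖ + b) else W y) ≤ L * ‖x - y‖ := by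
  have hge : W y ≤ (if y ∈ U then max (W y) (a * ‖y - x₀‖ + b) else W y) := by
    split_ifs <;> simp
  have hC : ∀ p q : Euc n, (a * ‖p - x₀‖ + b) - (a * ‖q - x₀‖ + b) ≤ L * ‖p - q‖ := fun p q =>
    (cone_sub_le a b x₀ p q).trans (by gcongr)
  rw [sub_le_iff_le_add]
  by_cases hx : x ∈ U
  · rw [if_pos hx]
    refine max_le (by linarith [hW x y]) ?_
    by_cases hy : y ∈ U
    · rw [if_pos hy]
      linarith [hC x y, le_max_right (W y) (a * ‖y - x₀‖ + b)]
    · obtain ⟨p, hp, hpU⟩ := exists_mem_segment_frontier hx hy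
      have h3 : ‖x - p‖ + ‖p - y‖ = ‖x - y‖ := by
        simpa [dist_eq_norm] using dist_add_dist_of_mem_segment hp
      rw [← h3]
      linarith [hC x p, hW p y, hf p hpU]
  · rw [if_neg hx]
    linarith [hW x y]

/-- Existence of infinity harmonic Lipschitz extensions, by the Perron method. -/
theorem exists_coneAbove_extension {n : ℕ} {D S : Set (Euc n)} (hS : S.Nonempty)
    (hDS : Disjoint D S) {g : Euc n → ℝ} {L : ℝ} (hL : 0 ≤ L)
    (hg : ∀ x ∈ S, ∀ y ∈ S, g x - g y ≤ L * ‖x - y‖) :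
    ∃ W : Euc n → ℝ, (∀ x y, W x - W y ≤ L * ‖x - y‖) ∧ (∀ x ∈ S, W x = g x) ∧
      ConeAbove D W ∧ ConeAbove D (fun x => -W x) := by
  classical
  obtain ⟨z₀, hz₀⟩ := hS
  let F : Set (Euc n → ℝ) := {w | (∀ x y, w x - w y ≤ L * ‖x - y‖) ∧ (∀ x ∈ S, w x = g x) ∧
    ConeAbove D w}
  have hFne : Nonempty F := by
    let c : S → Euc n → ℝ := fun z x => -L * ‖x - z‖ + g z
    have : Nonempty S := ⟨⟨z₀, hz₀⟩⟩
    have hle : ∀ z : S, ∀ y ∈ S, ∀ x, c z x ≤ g y + L * ‖x - y‖ := by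
      intro z y hy x
      have h1 := hg z z.2 y hy
      have h2 : L * ‖(z : Euc n) - y‖ ≤ L * (‖x - z‖ + ‖x - y‖) := by
        gcongr
        rw [norm_sub_rev x z]
        exact norm_sub_le_norm_sub_add_norm_sub _ _ _
      simp only [c]
      linarith
    have hb : ∀ x, BddAbove (range fun z => c z x) := fun x =>
      ⟨g z₀ + L * ‖x - z₀‖, by rintro _ ⟨z, rfl⟩; exact hle z z₀ hz₀ x⟩
    refine ⟨⟨fun x => ⨆ z, c z x, iSup_sub_le hb fun z x y => ?_, fun x hx => ?_,
      coneAbove_iSup hb fun z U hU hUb hUD x₀ hx₀ a b hf x hx => ?_⟩⟩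
    · have := cone_sub_le (-L) (g z) z x y
      rwa [abs_neg, abs_of_nonneg hL] at this
    · apply le_antisymm
      · exact ciSup_le fun z => by simpa using hle z x hx x
      · refine le_trans ?_ (le_ciSup (hb x) ⟨x, hx⟩)
        simp [c]
    · exact cone_le_cone hUb (fun h => disjoint_left.1 hDS (hUD h) z.2) hx₀ hf hx
  have hb : ∀ x, BddAbove (range fun w : F => (w : Euc n → ℝ) x) := fun x =>
    ⟨g z₀ + L * ‖x - z₀‖, by
      rintro _ ⟨w, rfl⟩
      have h1 := w.2.1 x z₀
      have h2 := w.2.2.1 z₀ hz₀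
      simp only
      linarith⟩
  set W : Euc n → ℝ := fun x => ⨆ w : F, (w : Euc n → ℝ) x with hWdef
  have hWlip : ∀ x y, W x - W y ≤ L * ‖x - y‖ := iSup_sub_le hb fun w => w.2.1
  have hWg : ∀ x ∈ S, W x = g x := fun x hx => by
    simp only [hWdef, (Subtype.prop _ : _ ∈ F).2.1 x hx, ciSup_const]
  have hWc : ConeAbove D W := coneAbove_iSup hb fun w => w.2.2.2
  refine ⟨W, hWlip, hWg, hWc, ?_⟩
  intro U hU hUb hUD x₀ hx₀ a b hf x hx
  rcases le_total L |a| with ha | ha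
  · exact le_cone_of_lipschitz hUb (fun x y => by rw [norm_sub_rev]; linarith [hWlip y x])
      hx₀ ha hf hx
  · have hf' : ∀ x ∈ frontier U, (-a) * ‖x - x₀‖ + (-b) ≤ W x := fun y hy => by
      linarith [hf y hy]
    have hmem : (fun x => if x ∈ U then max (W x) ((-a) * ‖x - x₀‖ + (-b)) else W x) ∈ F := by
      refine ⟨fun x y => glue_sub_le hWlip (by simpa using ha) hf' x y, fun y hy => ?_,
        coneAbove_glue hWc hU hx₀ hf'⟩
      simp only
      rw [if_neg fun h => disjoint_left.1 hDS (hUD h) hy, hWg y hy]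
    have h1 := le_ciSup (hb x) ⟨_, hmem⟩
    simp only [if_pos hx] at h1
    have h2 := (le_max_right _ _).trans h1
    have h3 : (⨆ w : F, (w : Euc n → ℝ) x) = W x := rfl
    rw [h3] at h2
    linarith

/-- The maximum of `u` over the closed ball of radius `ε` around `x`. -/
def ballSup {n : ℕ} (u : Euc n → ℝ) (ε : ℝ) (x : Euc n) : ℝ :=
  sSup ((fun b => u (x + b)) '' closedBall 0 ε)

theorem continuous_ballSup {n : ℕ} {u : Euc n → ℝ} (hu : Continuous u) (ε : ℝ) :
    Continuous (ballSup u ε) :=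
  (isCompact_closedBall (0 : Euc n) ε).continuous_sSup (f := fun x b => u (x + b)) (by fun_prop)

theorem le_ballSup {n : ℕ} {u : Euc n → ℝ} (hu : Continuous u) {ε : ℝ} {x y : Euc n}
    (h : ‖y - x‖ ≤ ε) : u y ≤ ballSup u ε x := by
  refine le_csSup ((isCompact_closedBall (0 : Euc n) ε).image (by fun_prop)).bddAbove
    ⟨y - x, by simpa using h, by simp⟩

theorem exists_eq_ballSup {n : ℕ} {u : Euc n → ℝ} (hu : Continuous u) {ε : ℝ} (hε : 0 ≤ ε)
    (x : Euc n) : ∃ y, ‖y - x‖ ≤ ε ∧ u y = ballSup u ε x := by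
  obtain ⟨b, hb, h⟩ := ((isCompact_closedBall (0 : Euc n) ε).image
    (f := fun b => u (x + b)) (by fun_prop)).sSup_mem ((nonempty_closedBall.2 hε).image _)
  exact ⟨x + b, by simpa using hb, h⟩

theorem ConeAbove.two_mul_le {n : ℕ} {U : Set (Euc n)} {u : Euc n → ℝ} (h : ConeAbove U u)
    {ε : ℝ} (hε : 0 < ε) {x : Euc n} (hx : closedBall x (2 * ε) ⊆ U) {M : ℝ}
    (hM : ∀ y, ‖y - x‖ ≤ 2 * ε → u y ≤ M) {y : Euc n} (hy : ‖y - x‖ ≤ ε) :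
    2 * u y ≤ u x + M := by
  have hxM : u x ≤ M := hM x (by simp; positivity)
  by_cases hyx : y = x
  · subst hyx; linarith
  have hO : IsOpen (ball x (2 * ε) \ {x}) := isOpen_ball.sdiff isClosed_singleton
  have key := h _ hO (isBounded_ball.subset sdiff_subset)
    (sdiff_subset.trans (ball_subset_closedBall.trans hx)) x (fun h => h.2 rfl)
    ((M - u x) / (2 * ε)) (u x) (by
      rw [hO.frontier_eq]
      rintro p ⟨hp, hp'⟩
      by_cases hpx : p = x
      · simp [hpx]
      · have h1 : p ∈ closedBall x (2 * ε) :=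
          closure_minimal (sdiff_subset.trans ball_subset_closedBall) isClosed_closedBall hp
        have h2 : p ∉ ball x (2 * ε) := fun h => hp' ⟨h, hpx⟩
        rw [mem_closedBall, dist_eq_norm] at h1
        rw [mem_ball, dist_eq_norm, not_lt] at h2
        rw [le_antisymm h1 h2, div_mul_cancel₀ _ (by positivity)]
        linarith [hM p h1]) y ⟨by rw [mem_ball, dist_eq_norm]; linarith, hyx⟩
  have h2 : (M - u x) / (2 * ε) * ‖y - x‖ ≤ (M - u x) / (2 * ε) * ε := by
    have : 0 ≤ (M - u x) / (2 * ε) := div_nonneg (by linarith) (by positivity)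
    gcongr
  have h3 : (M - u x) / (2 * ε) * ε = (M - u x) / 2 := by field_simp
  linarith

/-- The maximal function `ballSup u ε` is subharmonic for the discrete infinity Laplacian. -/
theorem ConeAbove.exists_two_mul_ballSup_le {n : ℕ} {U : Set (Euc n)} {u : Euc n → ℝ}
    (h : ConeAbove U u) (hu : Continuous u) {ε : ℝ} (hε : 0 < ε) {x : Euc n}
    (hx : closedBall x (2 * ε) ⊆ U) :
    ∃ z, ‖z - x‖ ≤ ε ∧ ∀ y, ‖y - x‖ ≤ ε → ballSup u ε y ≤ ballSup u ε z ∧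
      2 * ballSup u ε x ≤ ballSup u ε y + ballSup u ε z := by
  obtain ⟨z, hz, hmax⟩ := (isCompact_closedBall x ε).exists_isMaxOn
    (nonempty_closedBall.2 hε.le) (continuous_ballSup hu ε).continuousOn
  rw [mem_closedBall, dist_eq_norm] at hz
  refine ⟨z, hz, fun y hy => ⟨hmax (by rwa [mem_closedBall, dist_eq_norm]), ?_⟩⟩
  obtain ⟨w, hw, hwx⟩ := exists_eq_ballSup hu hε.le x
  have h1 : u x ≤ ballSup u ε y := le_ballSup hu (by rwa [norm_sub_rev])
  have h2 := h.two_mul_le hε hx (M := ballSup u ε z) (fun p hp => by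
    have hm : ‖(1 / 2 : ℝ) • (p - x)‖ ≤ ε := by
      rw [norm_smul, Real.norm_of_nonneg (by norm_num)]; linarith
    have e : p - (x + (1 / 2 : ℝ) • (p - x)) = (1 / 2 : ℝ) • (p - x) := by module
    refine (le_ballSup hu (x := x + (1 / 2 : ℝ) • (p - x)) (by rwa [e])).trans (hmax ?_)
    rw [mem_closedBall, dist_eq_norm, add_sub_cancel_left]
    exact hm) hw
  linarith

/-- Comparison principle for infinity harmonic functions (theorem of Jensen), by the discrete
argument of Armstrong and Smart. -/
theorem ConeAbove.le_of_frontier {n : ℕ} [Nontrivial (Euc n)] {U : Set (Euc n)} (hU : IsOpen U)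
    (hUb : IsBounded U) {u v : Euc n → ℝ} (hu : Continuous u) (hv : Continuous v)
    (hcu : ConeAbove U u) (hcv : ConeAbove U (fun x => -v x))
    (hf : ∀ x ∈ frontier U, u x ≤ v x) {x : Euc n} (hx : x ∈ U) : u x ≤ v x := by
  by_contra! hlt
  set v' : Euc n → ℝ := fun x => -v x with hv'
  have hvc : Continuous v' := hv.neg
  set m := u x - v x with hm
  have hm0 : 0 < m := by linarith
  have hK : IsCompact (closure U) := hUb.isCompact_closure
  obtain ⟨δ, hδ, hosc⟩ : ∃ δ > 0, ∀ p ∈ closure U, ∀ q, ‖q - p‖ < δ →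
      |u q - u p| < m / 2 ∧ |v' q - v' p| < m / 2 := by
    have hc : IsCompact (cthickening 1 (closure U)) := hK.cthickening
    have huc := Metric.uniformContinuousOn_iff.1 (hc.uniformContinuousOn_of_continuous
      hu.continuousOn) (m / 2) (by positivity)
    have hvuc := Metric.uniformContinuousOn_iff.1 (hc.uniformContinuousOn_of_continuous
      hvc.continuousOn) (m / 2) (by positivity)
    obtain ⟨δ₁, h1, hu1⟩ := huc
    obtain ⟨δ₂, h2, hv2⟩ := hvuc
    refine ⟨min 1 (min δ₁ δ₂), by positivity, fun p hp q hq => ?_⟩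
    have hp' : p ∈ cthickening 1 (closure U) := self_subset_cthickening _ hp
    have hq' : q ∈ cthickening 1 (closure U) := mem_cthickening_of_dist_le q p 1 _ hp (by
      rw [dist_eq_norm]; exact hq.le.trans (min_le_left _ _))
    rw [← dist_eq_norm] at hq
    exact ⟨hu1 q hq' p hp' (hq.trans_le ((min_le_right _ _).trans (min_le_left _ _))),
      hv2 q hq' p hp' (hq.trans_le ((min_le_right _ _).trans (min_le_right _ _)))⟩
  set ε := δ / 4 with hεdef
  have hε : 0 < ε := by positivity
  set P := ballSup u ε with hP
  set Q := ballSup v' ε with hQ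
  have hPc : Continuous P := continuous_ballSup hu ε
  have hQc : Continuous Q := continuous_ballSup hvc ε
  have hstrip : ∀ y ∈ closure U, m ≤ P y + Q y → closedBall y (2 * ε) ⊆ U := by
    intro y hy hmy
    by_contra hsub
    obtain ⟨q, hq, hqU⟩ := not_subset.1 hsub
    rw [mem_closedBall, dist_eq_norm] at hq
    obtain ⟨p, hp, hpU⟩ : ∃ p, ‖p - y‖ ≤ 2 * ε ∧ p ∈ frontier U := by
      by_cases hyU : y ∈ U
      · obtain ⟨p, hp, hpU⟩ := exists_mem_segment_frontier hyU hqU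
        refine ⟨p, ?_, hpU⟩
        have h3 : ‖y - p‖ + ‖p - q‖ = ‖y - q‖ := by
          simpa [dist_eq_norm] using dist_add_dist_of_mem_segment hp
        rw [norm_sub_rev y p, norm_sub_rev y q] at h3
        linarith [norm_nonneg (p - q)]
      · exact ⟨y, by simp; positivity, by rw [hU.frontier_eq]; exact ⟨hy, hyU⟩⟩
    have hpK := frontier_subset_closure hpU
    obtain ⟨z, hz, hzP⟩ := exists_eq_ballSup hu hε.le y
    obtain ⟨z', hz', hzQ⟩ := exists_eq_ballSup hvc hε.le y
    have hd : ∀ w, ‖w - y‖ ≤ ε → ‖w - p‖ < δ := fun w hw => by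
      have := norm_sub_le_norm_sub_add_norm_sub w y p
      rw [norm_sub_rev y p] at this
      linarith
    have h1 := abs_lt.1 (hosc p hpK z (hd z hz)).1
    have h2 := abs_lt.1 (hosc p hpK z' (hd z' hz')).2
    have h3 := hf p hpU
    simp only [hv'] at h2 hzQ
    simp only [hP, hQ] at hmy
    linarith [h1.2, h2.2]
  obtain ⟨x₁, hx₁, hmax⟩ := hK.exists_isMaxOn ⟨x, subset_closure hx⟩ (hPc.add hQc).continuousOn
  set h : Euc n → ℝ := fun x => P x + Q x with hh
  have hmax' : ∀ y ∈ closure U, h y ≤ h x₁ := fun y hy => hmax hy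
  have hx₁m : m ≤ h x₁ := by
    have h1 : u x ≤ P x := le_ballSup hu (by simp; positivity)
    have h2 : v' x ≤ Q x := le_ballSup hvc (by simp; positivity)
    have h3 := hmax' x (subset_closure hx)
    simp only [hh, hv'] at *
    linarith
  set E := closure U ∩ {y | h y = h x₁} with hE
  have hEc : IsCompact E := hK.inter_right (isClosed_eq (hPc.add hQc) continuous_const)
  obtain ⟨x₂, hx₂, hmaxP⟩ := hEc.exists_isMaxOn ⟨x₁, hx₁, rfl⟩ hPc.continuousOn
  set G := E ∩ {y | P y = P x₂} with hG
  have hGc : IsCompact G := hEc.inter_right (isClosed_eq hPc continuous_const)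
  obtain ⟨e, he⟩ := exists_norm_eq (Euc n) zero_le_one
  obtain ⟨x₃, hx₃, hmaxe⟩ := hGc.exists_isMaxOn ⟨x₂, hx₂, rfl⟩
    (f := fun y => inner ℝ e y) (by fun_prop)
  have hh₃ : h x₃ = h x₁ := hx₃.1.2
  have hP₃ : P x₃ = P x₂ := hx₃.2
  have hball := hstrip x₃ hx₃.1.1 (hx₁m.trans_eq hh₃.symm)
  have hin : ∀ y, ‖y - x₃‖ ≤ ε → y ∈ closure U := fun y hy => subset_closure (hball (by
    rw [mem_closedBall, dist_eq_norm]; linarith))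
  obtain ⟨z, hz, hzP⟩ := hcu.exists_two_mul_ballSup_le hu hε hball
  obtain ⟨z', hz', hzQ⟩ := hcv.exists_two_mul_ballSup_le hvc hε hball
  rw [← hP] at hzP
  rw [← hQ] at hzQ
  have h1 := hzP z' hz'
  have h2 := hzQ z hz
  have hzle : h z ≤ h x₁ := hmax' z (hin z hz)
  have hzle' : h z' ≤ h x₁ := hmax' z' (hin z' hz')
  have hzE : z ∈ E := ⟨hin z hz, by
    simp only [mem_ofPred_eq]; simp only [hh] at *; linarith⟩
  have hPz : P z ≤ P x₂ := hmaxP hzE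
  -- Now `P` and `Q` are both constant on the ball around `x₃`.
  have hmem : x₃ + ε • e ∈ G := by
    have hy : ‖(x₃ + ε • e) - x₃‖ ≤ ε := by
      rw [add_sub_cancel_left, norm_smul, he, Real.norm_of_nonneg hε.le, mul_one]
    have h3 := hzP _ hy
    have h4 := hzQ _ hy
    refine ⟨⟨hin _ hy, ?_⟩, ?_⟩ <;> simp only [mem_ofPred_eq] <;> simp only [hh] at * <;> linarith
  have : inner ℝ e (x₃ + ε • e) ≤ inner ℝ e x₃ := hmaxe hmem
  rw [inner_add_right, real_inner_smul_right, real_inner_self_eq_norm_sq, he] at this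
  linarith

theorem ConeAbove.mono {n : ℕ} {D D' : Set (Euc n)} {u : Euc n → ℝ} (h : ConeAbove D u)
    (hD : D' ⊆ D) : ConeAbove D' u := fun U hU hUb hUD => h U hU hUb (hUD.trans hD)

theorem ConeAbove.add_const {n : ℕ} {D : Set (Euc n)} {u : Euc n → ℝ} (h : ConeAbove D u)
    (c : ℝ) : ConeAbove D (fun x => u x + c) := by
  intro U hU hUb hUD x₀ hx₀ a b hf x hx
  have := h U hU hUb hUD x₀ hx₀ a (b - c) (fun y hy => by linarith [hf y hy]) x hx
  linarith

theorem mem_frontier_compl_inter_ball {n : ℕ} {A : Set (Euc n)} (hA : IsClosed A) {r : ℝ}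
    {p : Euc n} (hp : p ∈ frontier (Aᶜ ∩ ball 0 r)) :
    p ∈ closure Aᶜ ∧ (p ∈ frontier A ∨ ‖p‖ = r) := by
  rw [(hA.isOpen_compl.inter isOpen_ball).frontier_eq] at hp
  have h1 : p ∈ closure Aᶜ := closure_mono inter_subset_left hp.1
  have h2 : p ∈ closedBall (0 : Euc n) r :=
    closure_minimal (inter_subset_right.trans ball_subset_closedBall) isClosed_closedBall hp.1
  refine ⟨h1, ?_⟩
  by_cases hpA : p ∈ A
  · left
    rw [frontier_eq_closure_inter_closure]
    exact ⟨subset_closure hpA, h1⟩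
  · right
    have h3 : p ∉ ball (0 : Euc n) r := fun h => hp.2 ⟨hpA, h⟩
    rw [mem_closedBall_zero_iff] at h2
    rw [mem_ball_zero_iff, not_lt] at h3
    exact le_antisymm h2 h3

/-- Asymptotic slope at most one gives the bound by a cone of slope one. -/
theorem ConeAbove.le_add_norm {n : ℕ} {A : Set (Euc n)} (hA : IsClosed A)
    (h0 : (0 : Euc n) ∈ A) {u : Euc n → ℝ} (h : ConeAbove Aᶜ u) {m : ℝ}
    (hm : ∀ x ∈ frontier A, u x ≤ m) {S : ℝ → ℝ} (hS : Tendsto S atTop (𝓝 1))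
    (hSr : ∀ᶠ r in atTop, 0 ≤ S r ∧ ∀ x : Euc n, ‖x‖ = r → u x ≤ m + S r * r)
    {x : Euc n} (hx : x ∈ Aᶜ) : u x ≤ m + ‖x‖ := by
  have hlim : Tendsto (fun r => m + S r * ‖x‖) atTop (𝓝 (m + 1 * ‖x‖)) :=
    tendsto_const_nhds.add (hS.mul_const _)
  rw [one_mul] at hlim
  refine ge_of_tendsto hlim ?_
  filter_upwards [hSr, eventually_gt_atTop ‖x‖] with r hr hxr
  have := h (Aᶜ ∩ ball 0 r) (hA.isOpen_compl.inter isOpen_ball)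
    (isBounded_ball.subset inter_subset_right) inter_subset_left 0 (fun h => h.1 h0) (S r) m
    (fun p hp => ?_) x ⟨hx, by rwa [mem_ball_zero_iff]⟩
  · rw [sub_zero] at this
    linarith
  · rw [sub_zero]
    rcases (mem_frontier_compl_inter_ball hA hp).2 with h1 | h1
    · have := mul_nonneg hr.1 (norm_nonneg p)
      linarith [hm p h1]
    · rw [h1]
      linarith [hr.2 p h1]

/-- Far from `A` the Lipschitz constant is close to one. -/
theorem ConeAbove.le_add_mul_norm_sub {n : ℕ} {A : Set (Euc n)} (hA : IsClosed A)
    (hA1 : A ⊆ ball 0 1) {u : Euc n → ℝ} (h : ConeAbove Aᶜ u) {M : ℝ} (hM : 0 ≤ M)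
    (hu : ∀ x ∈ closure Aᶜ, |u x| ≤ M + ‖x‖) {R : ℝ} (hR : 1 < R) {x y : Euc n}
    (hx : ‖x‖ = R) (hy : y ∈ Aᶜ) :
    u y ≤ u x + (2 * M + R + 1) / (R - 1) * ‖y - x‖ := by
  set a := (2 * M + R + 1) / (R - 1) with ha
  have hR1 : 0 < R - 1 := by linarith
  have ha1 : a * (R - 1) = 2 * M + R + 1 := div_mul_cancel₀ _ hR1.ne'
  have ha2 : 1 < a := by rw [ha, lt_div_iff₀ hR1]; linarith
  by_cases hyx : y = x
  · simp [hyx]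
  have hxA : x ∈ Aᶜ := fun hxA => by
    have := hA1 hxA
    rw [mem_ball_zero_iff] at this
    linarith
  have hux := abs_le.1 (hu x (subset_closure hxA))
  obtain ⟨ρ, hρ1, hρ2⟩ : ∃ ρ, ‖y‖ < ρ ∧ 2 * M + R + a * R ≤ (a - 1) * ρ := by
    refine ⟨max (‖y‖ + 1) ((2 * M + R + a * R) / (a - 1)), lt_max_of_lt_left (by linarith), ?_⟩
    rw [← div_le_iff₀' (by linarith)]
    exact le_max_right _ _
  have hV : IsOpen ((A ∪ {x})ᶜ) := (hA.union isClosed_singleton).isOpen_compl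
  have key := h ((A ∪ {x})ᶜ ∩ ball 0 ρ) (hV.inter isOpen_ball)
    (isBounded_ball.subset inter_subset_right)
    (inter_subset_left.trans (compl_subset_compl.2 subset_union_left)) x
    (fun h => h.1 (Or.inr rfl)) a (u x) (fun p hp => ?_) y
    ⟨by rintro (h | h); exacts [hy h, hyx h], by rwa [mem_ball_zero_iff]⟩
  · linarith
  · obtain ⟨hp1, hp2⟩ := mem_frontier_compl_inter_ball (hA.union isClosed_singleton) hp
    have hup := abs_le.1 (hu p (closure_mono (compl_subset_compl.2 subset_union_left) hp1))
    rcases hp2 with hp2 | hp2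
    · rcases (hA.union isClosed_singleton).frontier_subset hp2 with hpA | hpx
      · have h1 : ‖p‖ < 1 := by simpa using hA1 hpA
        have h2 : R - 1 ≤ ‖p - x‖ := by
          have := norm_sub_norm_le x p
          rw [norm_sub_rev] at this
          linarith
        have h3 : a * (R - 1) ≤ a * ‖p - x‖ := by gcongr
        rw [hx] at hux
        linarith [hup.2, hux.1]
      · rw [mem_singleton_iff.1 hpx]; simp
    · have h2 : ρ - R ≤ ‖p - x‖ := by
        have := norm_sub_norm_le p x
        linarith
      have h3 : a * (ρ - R) ≤ a * ‖p - x‖ := by gcongr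
      rw [hx] at hux
      rw [hp2] at hup
      linarith [hup.2, hux.1]

/-- Infinity harmonic functions on large balls lying on one side of `u`. -/
theorem exists_one_sided_on_ball {n : ℕ} [Nontrivial (Euc n)] {A : Set (Euc n)}
    (hA : IsClosed A) (h0 : (0 : Euc n) ∈ A) (hA1 : A ⊆ ball 0 1) {u : Euc n → ℝ}
    (huc : Continuous u) (h : ConeAbove Aᶜ u) (h' : ConeAbove Aᶜ (fun x => -u x)) {M : ℝ}
    (hM : 0 ≤ M) (hu : ∀ x ∈ closure Aᶜ, |u x| ≤ M + ‖x‖) {R L : ℝ} (hR : 1 < R)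
    (hL : L = (2 * M + R + 1) / (R - 1)) :
    ∃ W : Euc n → ℝ, (∀ x y, W x - W y ≤ L * ‖x - y‖) ∧ |W 0| ≤ M + 1 + L ∧
      ConeAbove (ball 0 R) W ∧ ConeAbove (ball 0 R) (fun x => -W x) ∧
      ((∀ x ∈ Aᶜ ∩ ball 0 R, W x ≤ u x) ∨ (∀ x ∈ Aᶜ ∩ ball 0 R, u x ≤ W x)) := by
  have hL0 : 0 ≤ L := by
    rw [hL]; exact div_nonneg (by linarith) (by linarith)
  have hsA : ∀ x : Euc n, ‖x‖ = R → x ∈ Aᶜ := fun x hx hxA => by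
    have := hA1 hxA
    rw [mem_ball_zero_iff] at this
    linarith
  obtain ⟨W, hWl, hWg, hW, hW'⟩ := exists_coneAbove_extension (D := ball (0 : Euc n) R)
    (S := sphere 0 R) (NormedSpace.sphere_nonempty.2 (by linarith))
    (disjoint_left.2 fun x hx hx' => by
      rw [mem_ball_zero_iff] at hx; rw [mem_sphere_zero_iff_norm] at hx'; linarith)
    (g := u) hL0 (fun x hx y hy => by
      rw [mem_sphere_zero_iff_norm] at hx hy
      have := h.le_add_mul_norm_sub hA hA1 hM hu hR hy (hsA x hx)
      rw [hL]; linarith)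
  have hfr : (frontier A).Nonempty := by
    rw [nonempty_frontier_iff]
    refine ⟨⟨0, h0⟩, fun hA' => ?_⟩
    obtain ⟨x, hx⟩ := exists_norm_eq (Euc n) (show 0 ≤ R by linarith)
    exact hsA x hx (by rw [hA']; trivial)
  have hWc : Continuous W := by
    refine (LipschitzWith.of_le_add_mul ⟨L, hL0⟩ fun x y => ?_).continuous
    change W x ≤ W y + L * dist x y
    rw [dist_eq_norm]
    linarith [hWl x y]
  have hfrc : IsCompact (frontier A) :=
    (isBounded_ball.subset hA1).isCompact_closure.of_isClosed_subset isClosed_frontier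
      frontier_subset_closure
  have hnorm : ∀ (c : ℝ) (p : Euc n), p ∈ frontier A → W p + c = u p →
      |W 0 + c| ≤ M + 1 + L := by
    intro c p hp hpc
    have hp1 : ‖p‖ < 1 := by simpa using hA1 (hA.frontier_subset hp)
    have h1 := hWl 0 p
    have h2 := hWl p 0
    rw [zero_sub, norm_neg] at h1
    rw [sub_zero] at h2
    have h3 : L * ‖p‖ ≤ L * 1 := by gcongr
    have h4 := abs_le.1 (hu p (by
      rw [frontier_eq_closure_inter_closure] at hp; exact hp.2))
    rw [abs_le]
    constructor <;> linarith [h4.1, h4.2]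
  have hUo : IsOpen (Aᶜ ∩ ball (0 : Euc n) R) := hA.isOpen_compl.inter isOpen_ball
  have hUb : IsBounded (Aᶜ ∩ ball (0 : Euc n) R) := isBounded_ball.subset inter_subset_right
  obtain ⟨p, hp, hpmin⟩ := hfrc.exists_isMinOn hfr (huc.sub hWc).continuousOn
  obtain ⟨q, hq, hqmax⟩ := hfrc.exists_isMaxOn hfr (huc.sub hWc).continuousOn
  have hpmin' : ∀ y ∈ frontier A, u p - W p ≤ u y - W y := fun y hy => hpmin hy
  have hqmax' : ∀ y ∈ frontier A, u y - W y ≤ u q - W q := fun y hy => hqmax hy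
  have hneg : ∀ c : ℝ, ConeAbove (ball 0 R) (fun x => -(W x + c)) := fun c => by
    simpa only [neg_add] using hW'.add_const (-c)
  rcases le_total (u p - W p) 0 with hc | hc
  · refine ⟨fun x => W x + (u p - W p), fun x y => by simpa using hWl x y,
      hnorm _ p hp (by ring), hW.add_const _, hneg _, Or.inl fun x hx => ?_⟩
    refine ((hW.add_const _).mono inter_subset_right).le_of_frontier hUo hUb (by fun_prop) huc
      (h'.mono inter_subset_left) (fun z hz => ?_) hx
    rcases (mem_frontier_compl_inter_ball hA hz).2 with h1 | h1
    · linarith [hpmin' z h1]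
    · linarith [hWg z (by simpa using h1)]
  · have hc' := hqmax' p hp
    refine ⟨fun x => W x + (u q - W q), fun x y => by simpa using hWl x y,
      hnorm _ q hq (by ring), hW.add_const _, hneg _, Or.inr fun x hx => ?_⟩
    refine (h.mono inter_subset_left).le_of_frontier hUo hUb huc (by fun_prop)
      ((hneg _).mono inter_subset_right) (fun z hz => ?_) hx
    rcases (mem_frontier_compl_inter_ball hA hz).2 with h1 | h1
    · linarith [hqmax' z h1]
    · linarith [hWg z (by simpa using h1)]

/-- Stability of comparison with cones under pointwise limits of equi-Lipschitz functions. -/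
theorem coneAbove_of_tendsto {n : ℕ} {ι : Type*} {l : Filter ι} [NeBot l] {w : ι → Euc n → ℝ}
    {W : Euc n → ℝ} {Λ : ℝ} (hΛ : 0 ≤ Λ) (hl : ∀ k x y, w k x - w k y ≤ Λ * ‖x - y‖)
    (hc : ∀ r : ℝ, ∀ᶠ k in l, ConeAbove (ball 0 r) (w k))
    (hW : ∀ x, Tendsto (fun k => w k x) l (𝓝 (W x))) : ConeAbove univ W := by
  intro U hU hUb _ x₀ hx₀ a b hf x hx
  refine le_of_forall_pos_le_add fun δ hδ => ?_
  obtain ⟨r, hr⟩ := hUb.subset_ball 0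
  set ρ := δ / 2 / (Λ + |a| + 1) with hρ
  have hden : 0 < Λ + |a| + 1 := by positivity
  have hρ0 : 0 < ρ := by positivity
  have hρ1 : (Λ + |a| + 1) * ρ = δ / 2 := mul_div_cancel₀ _ hden.ne'
  obtain ⟨t, htU, htf, htc⟩ := (hUb.isCompact_closure.of_isClosed_subset isClosed_frontier
    frontier_subset_closure).finite_cover_balls hρ0
  have hev : ∀ᶠ k in l, ∀ p ∈ t, w k p < W p + δ / 2 := by
    rw [htf.eventually_all]
    exact fun p _ => (hW p).eventually_lt_const (by linarith)
  refine le_of_tendsto (hW x) ?_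
  filter_upwards [hev, hc r] with k hk hck
  have := hck U hU hUb hr x₀ hx₀ a (b + δ) (fun q hq => ?_) x hx
  · linarith
  · obtain ⟨p, hp, hqp⟩ := mem_iUnion₂.1 (htc hq)
    rw [mem_ball, dist_eq_norm] at hqp
    have h1 := hl k q p
    have h2 := cone_sub_le a b x₀ p q
    rw [norm_sub_rev p q] at h2
    have h3 : (Λ + |a| + 1) * ‖q - p‖ ≤ (Λ + |a| + 1) * ρ := by gcongr
    linarith [hk p hp, hf p (htU hp), norm_nonneg (q - p)]

/-- if S⁻_∞ = S⁺_∞ = 1, there is an entire infinity harmonic function W with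
Lip(W,ℝⁿ) ≤ 1 lying entirely below or entirely above u on Ω. -/
theorem stmt16 {n : ℕ} (A : Set (Euc n)) (hAcl : IsClosed A) (hAbd : IsBounded A)
    (h0A : (0 : Euc n) ∈ A) (hA1 : A ⊆ ball 0 1)
    (u : Euc n → ℝ) (hu : ContinuousOn u (closure Aᶜ)) (hIH : InfHarmonic Aᶜ u)
    (hSp : Tendsto (SP Aᶜ u) atTop (𝓝 1)) (hSm : Tendsto (SM Aᶜ u) atTop (𝓝 1)) :
    ∃ W : Euc n → ℝ, Continuous W ∧ InfHarmonic (univ : Set (Euc n)) W ∧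
      (∀ x y : Euc n, |W x - W y| ≤ ‖x - y‖) ∧
      ((∀ x ∈ Aᶜ, W x ≤ u x) ∨ (∀ x ∈ Aᶜ, u x ≤ W x)) := by
  rcases subsingleton_or_nontrivial (Euc n) with hsub | hnt
  · have hA : Aᶜ = ∅ := by
      rw [compl_empty_iff]
      exact eq_univ_of_forall fun x => Subsingleton.elim 0 x ▸ h0A
    have h0 : SP Aᶜ u =ᶠ[atTop] fun _ => 0 := by
      filter_upwards [eventually_gt_atTop 0] with r hr
      have hs : sphere (0 : Euc n) r = ∅ := by
        refine eq_empty_of_forall_notMem fun x hx => ?_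
        rw [Subsingleton.elim x 0] at hx
        simp only [mem_sphere_iff_norm, sub_self, norm_zero] at hx
        exact hr.ne hx
      simp [SP, mP, hA, hs]
    have := tendsto_nhds_unique (hSp.congr' h0) tendsto_const_nhds
    norm_num at this
  obtain ⟨v, hv⟩ := ContinuousMap.exists_restrict_eq isClosed_closure
    (⟨_, hu.domRestrict⟩ : C(closure Aᶜ, ℝ))
  have hvu : ∀ x ∈ closure Aᶜ, v x = u x := fun x hx => DFunLike.congr_fun hv ⟨x, hx⟩
  have hvc : Continuous v := v.continuous
  have hab : ConeAbove Aᶜ v :=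
    (hIH.1.congr fun x hx => (hvu x (subset_closure hx)).symm).coneAbove hvc
  have hbe : ConeAbove Aᶜ (fun x => -v x) :=
    ((cmpBelow_iff_cmpAbove_neg.1 hIH.2).congr fun x hx => by
      rw [hvu x (subset_closure hx)]).coneAbove hvc.neg
  have hfr : frontier Aᶜ ⊆ closure Aᶜ := frontier_subset_closure
  have hfrc : IsCompact (frontier Aᶜ) := by
    rw [frontier_compl]
    exact hAbd.isCompact_closure.of_isClosed_subset isClosed_frontier frontier_subset_closure
  have hsph : ∀ r : ℝ, 1 ≤ r → sphere (0 : Euc n) r ⊆ closure Aᶜ := fun r hr x hx =>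
    subset_closure fun hxA => by
      have := hA1 hxA
      rw [mem_ball_zero_iff] at this
      rw [mem_sphere_zero_iff_norm] at hx
      linarith
  have hup : ∀ x ∈ Aᶜ, v x ≤ mP Aᶜ u + ‖x‖ := fun x hx => by
    refine hab.le_add_norm hAcl h0A (fun p hp => ?_) hSp ?_ hx
    · rw [← frontier_compl] at hp
      rw [hvu p (hfr hp)]
      exact le_csSup (hfrc.image_of_continuousOn (hu.mono hfr)).bddAbove ⟨p, hp, rfl⟩
    · filter_upwards [eventually_ge_atTop 1] with r hr
      have hr0 : 0 < r := by linarith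
      refine ⟨div_nonneg (sub_nonneg.2 (le_max_right _ _)) hr0.le, fun p hp => ?_⟩
      have hp' : p ∈ sphere (0 : Euc n) r := by simpa using hp
      rw [SP, div_mul_cancel₀ _ hr0.ne', hvu p (hsph r hr hp')]
      have := le_csSup ((isCompact_sphere (0 : Euc n) r).image_of_continuousOn
        (hu.mono (hsph r hr))).bddAbove ⟨p, hp', rfl⟩
      linarith [le_max_left (sSup (u '' sphere (0 : Euc n) r)) (mP Aᶜ u)]
  have hlo : ∀ x ∈ Aᶜ, -v x ≤ -mM Aᶜ u + ‖x‖ := fun x hx => by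
    refine hbe.le_add_norm hAcl h0A (fun p hp => ?_) hSm ?_ hx
    · rw [← frontier_compl] at hp
      rw [hvu p (hfr hp), neg_le_neg_iff]
      exact csInf_le (hfrc.image_of_continuousOn (hu.mono hfr)).bddBelow ⟨p, hp, rfl⟩
    · filter_upwards [eventually_ge_atTop 1] with r hr
      have hr0 : 0 < r := by linarith
      refine ⟨div_nonneg (sub_nonneg.2 (min_le_right _ _)) hr0.le, fun p hp => ?_⟩
      have hp' : p ∈ sphere (0 : Euc n) r := by simpa using hp
      rw [SM, div_mul_cancel₀ _ hr0.ne', hvu p (hsph r hr hp')]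
      have := csInf_le ((isCompact_sphere (0 : Euc n) r).image_of_continuousOn
        (hu.mono (hsph r hr))).bddBelow ⟨p, hp', rfl⟩
      linarith [min_le_left (sInf (u '' sphere (0 : Euc n) r)) (mM Aᶜ u)]
  obtain ⟨M, hM, hvM⟩ : ∃ M : ℝ, 0 ≤ M ∧ ∀ x ∈ closure Aᶜ, |v x| ≤ M + ‖x‖ := by
    refine ⟨max |mP Aᶜ u| |mM Aᶜ u|, le_max_of_le_left (abs_nonneg _), fun x hx => ?_⟩
    refine closure_minimal (t := {x | |v x| ≤ max |mP Aᶜ u| |mM Aᶜ u| + ‖x‖}) (fun y hy => ?_)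
      (isClosed_le (by fun_prop) (by fun_prop)) hx
    rw [mem_ofPred_eq, abs_le']
    constructor
    · linarith [hup y hy, le_max_left |mP Aᶜ u| |mM Aᶜ u|, le_abs_self (mP Aᶜ u)]
    · linarith [hlo y hy, le_max_right |mP Aᶜ u| |mM Aᶜ u|, neg_abs_le (mM Aᶜ u)]
  set L : ℕ → ℝ := fun k => (2 * M + ((k : ℝ) + 2) + 1) / (((k : ℝ) + 2) - 1) with hLdef
  have hLeq : ∀ k : ℕ, L k = 1 + (2 * M + 2) / ((k : ℝ) + 1) := fun k => by
    simp only [hLdef]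
    have h1 : (k : ℝ) + 1 ≠ 0 := by positivity
    rw [show (k : ℝ) + 2 - 1 = k + 1 by ring]
    field_simp
    ring
  have hLΛ : ∀ k, L k ≤ 2 * M + 3 := fun k => by
    have : (2 * M + 2) / ((k : ℝ) + 1) ≤ 2 * M + 2 :=
      div_le_self (by linarith) (by linarith [Nat.cast_nonneg (α := ℝ) k])
    linarith [hLeq k]
  have hLlim : Tendsto L atTop (𝓝 1) := by
    have h1 : Tendsto (fun k : ℕ => 1 + (2 * M + 2) / ((k : ℝ) + 1)) atTop (𝓝 (1 + 0)) :=
      tendsto_const_nhds.add (tendsto_const_nhds.div_atTop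
        (tendsto_atTop_add_const_right _ _ tendsto_natCast_atTop_atTop))
    rw [add_zero] at h1
    exact h1.congr fun k => (hLeq k).symm
  choose w hwl hw0 hwa hwb hws using fun k : ℕ => exists_one_sided_on_ball hAcl h0A hA1 hvc hab
    hbe hM hvM (R := (k : ℝ) + 2) (L := L k) (by linarith [Nat.cast_nonneg (α := ℝ) k]) rfl
  have hwΛ : ∀ k x y, w k x - w k y ≤ (2 * M + 3) * ‖x - y‖ := fun k x y =>
    (hwl k x y).trans (by gcongr; exact hLΛ k)
  set l : Ultrafilter ℕ := hyperfilter ℕ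
  have hl : (l : Filter ℕ) ≤ atTop := Nat.hyperfilter_le_atTop
  have hlim : ∀ x, ∃ y, Tendsto (fun k => w k x) l (𝓝 y) := fun x => by
    obtain ⟨y, -, hy⟩ := (isCompact_Icc (a := -(M + 1 + (2 * M + 3) + (2 * M + 3) * ‖x‖))
      (b := M + 1 + (2 * M + 3) + (2 * M + 3) * ‖x‖)).ultrafilter_le_nhds
      (l.map fun k => w k x) (by
        rw [le_principal_iff]
        refine Filter.mem_map.2 (univ_mem' fun k => ?_)
        have h1 := hwΛ k x 0
        have h2 := hwΛ k 0 x
        rw [sub_zero] at h1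
        rw [zero_sub, norm_neg] at h2
        have h3 := abs_le.1 (hw0 k)
        have h4 := hLΛ k
        constructor <;> linarith [h3.1, h3.2])
    exact ⟨y, hy⟩
  choose W hW using hlim
  have hball : ∀ r : ℝ, ∀ᶠ k : ℕ in l, ball (0 : Euc n) r ⊆ ball 0 ((k : ℝ) + 2) := fun r => by
    filter_upwards [hl (tendsto_natCast_atTop_atTop.eventually_ge_atTop r)] with k hk
    exact ball_subset_ball (by linarith)
  have hWl : ∀ x y, W x - W y ≤ ‖x - y‖ := fun x y => by
    have := le_of_tendsto_of_tendsto' ((hW x).sub (hW y))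
      ((hLlim.mono_left hl).mul_const ‖x - y‖) fun k => hwl k x y
    rwa [one_mul] at this
  have hWa : ConeAbove univ W := coneAbove_of_tendsto (by linarith) hwΛ
    (fun r => (hball r).mono fun k hk => (hwa k).mono hk) hW
  have hWb : ConeAbove univ (fun x => -W x) := coneAbove_of_tendsto (Λ := 2 * M + 3)
    (by linarith) (fun k x y => by rw [norm_sub_rev]; linarith [hwΛ k y x])
    (fun r => (hball r).mono fun k hk => (hwb k).mono hk) (fun x => (hW x).neg)
  have hmem : ∀ x ∈ Aᶜ, ∀ᶠ k : ℕ in l, x ∈ Aᶜ ∩ ball 0 ((k : ℝ) + 2) := fun x hx =>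
    (hball (‖x‖ + 1)).mono fun k hk => ⟨hx, hk (by simp)⟩
  refine ⟨W, (LipschitzWith.of_le_add_mul 1 fun x y => ?_).continuous,
    ⟨hWa.cmpAbove, cmpBelow_iff_cmpAbove_neg.2 hWb.cmpAbove⟩, fun x y => ?_, ?_⟩
  · rw [dist_eq_norm, NNReal.coe_one, one_mul]
    linarith [hWl x y]
  · rw [abs_le']
    exact ⟨hWl x y, by rw [norm_sub_rev]; linarith [hWl y x]⟩
  · rcases Ultrafilter.eventually_or.1 (Eventually.of_forall (f := (l : Filter ℕ)) hws)
      with hs | hs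
    · left
      intro x hx
      rw [← hvu x (subset_closure hx)]
      refine le_of_tendsto (hW x) ?_
      filter_upwards [hs, hmem x hx] with k hk hxk
      exact hk x hxk
    · right
      intro x hx
      rw [← hvu x (subset_closure hx)]
      refine ge_of_tendsto (hW x) ?_
      filter_upwards [hs, hmem x hx] with k hk hxk
      exact hk x hxk
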